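/- Let G be a group with finite generating set and decidable word problem, let H be a finitely generated recursively presented group, and let A ⊆ ℕ be Σ⁰₁. Then the group K(G,A,H), with its distinguished finite generating set, is recursively presented. -/

import Mathlib

open Classical in
/-- Characteristic sequence of a set of naturals. -/
noncomputable def charSeq (A : Set ℕ) : ℕ → Bool := fun i => decide (i ∈ A)

/-- The length-`m` prefix of the characteristic sequence of `A`. -/
noncomputable def charPrefix (A : Set ℕ) (m : ℕ) : List Bool :=
  (List.range m).map (charSeq A)

/-- `A` is Σ⁰₁ (recursively enumerable). -/
def IsSigma01 (A : Set ℕ) : Prop :=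
  ∃ f : ℕ →. ℕ, Partrec f ∧ ∀ n, n ∈ A ↔ (f n).Dom

/-- `A` many-one reduces to `B`. -/
def ManyOneRed (A B : Set ℕ) : Prop :=
  ∃ f : ℕ → ℕ, Computable f ∧ ∀ n, n ∈ A ↔ f n ∈ B

/-- `A` is `φ`-impredictable with witness `ψ`. -/
def ImpredictableWith (φ : ℕ → ℕ) (A : Set ℕ) (ψ : ℕ → ℕ) : Prop :=
  ∀ χ : ℕ × List Bool →. ℕ, Partrec χ →
    ∀ N : ℕ, ∃ p : ℕ, N ≤ p ∧ (ψ p ∈ A ↔ (χ (p, charPrefix A (φ p))).Dom)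

/-- `A` is `φ`-impredictable. -/
def Impredictable (φ : ℕ → ℕ) (A : Set ℕ) : Prop :=
  ∃ ψ : ℕ → ℕ, Computable ψ ∧ ImpredictableWith φ A ψ

/-- Bitwise comparison of binary strings of equal length. -/
def bitLE (u v : List Bool) : Prop := List.Forall₂ (· ≤ ·) u v

/-- `B` wtt-reduces to `A` with rate `β`. -/
def WttRedRate (B A : Set ℕ) (β : ℕ → ℕ) : Prop :=
  Computable β ∧ Monotone β ∧ Filter.Tendsto β Filter.atTop Filter.atTop ∧
  ∃ g : List Bool →. List Bool, Partrec g ∧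
    ∀ m : ℕ, ∃ out : List Bool, out ∈ g (charPrefix A m) ∧
      out = charPrefix B out.length ∧ β m ≤ out.length

/-- `B` conjunctively reduces to `A` with rate `β`. -/
def ConjRedRate (B A : Set ℕ) (β : ℕ → ℕ) : Prop :=
  Computable β ∧ Monotone β ∧ Filter.Tendsto β Filter.atTop Filter.atTop ∧
  ∃ g : List Bool → List Bool, Computable g ∧
    (∀ w : List Bool, (g w).length = β w.length) ∧
    (∀ u v : List Bool, bitLE u v → bitLE (g u) (g v)) ∧
    (∀ m : ℕ, g (charPrefix A m) = charPrefix B (β m)) ∧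
    ∃ w : ℕ → ℕ → List Bool, Computable₂ w ∧ (∀ i m, (w i m).length = m) ∧
      ∀ (u v : List Bool) (i : ℕ), u.length = v.length →
        (bitLE (w i u.length) u ↔ bitLE (w i u.length) v) →
        (g u).getD i false = (g v).getD i false

/-- Evaluation of a word over the generators (`true` = generator, `false` = inverse). -/
def evalWord {K : Type*} [Group K] {m : ℕ} (gen : Fin m → K) (w : List (Fin m × Bool)) : K :=
  (w.map fun l => if l.2 then gen l.1 else (gen l.1)⁻¹).prod

/-- Index of a word in the length-then-lexicographic enumeration of all words
(bijective base-`2m` numeration). -/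
def wordCode {m : ℕ} (w : List (Fin m × Bool)) : ℕ :=
  w.foldl (fun acc l => acc * (2 * m) + (2 * l.1.val + (if l.2 then 1 else 0) + 1)) 0

/-- The word problem of a group with distinguished generators. -/
def WordProblem {K : Type*} [Group K] {m : ℕ} (gen : Fin m → K) : Set ℕ :=
  { n | ∃ w : List (Fin m × Bool), wordCode w = n ∧ evalWord gen w = 1 }

/-- Word norm with respect to the distinguished generators. -/
noncomputable def wordNorm {K : Type*} [Group K] {m : ℕ} (gen : Fin m → K) (g : K) : ℕ :=
  sInf { ℓ | ∃ w : List (Fin m × Bool), w.length = ℓ ∧ evalWord gen w = g }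

/-- The torsion function of a group with distinguished generators. -/
noncomputable def torsionFn {K : Type*} [Group K] {m : ℕ} (gen : Fin m → K) (n : ℕ) : ℕ :=
  sSup { k | ∃ g : K, wordNorm gen g ≤ n ∧ orderOf g = k }

/-- Word metric on a group with distinguished generators. -/
noncomputable def wordDist {G : Type*} [Group G] {m : ℕ} (gen : Fin m → G) (a b : G) : ℕ :=
  wordNorm gen (a⁻¹ * b)

/-- The subshift `X_A`: configurations with at most two `1`s, whose distance is not in `A`. -/
def XA {G : Type*} [Group G] {m : ℕ} (gen : Fin m → G) (A : Set ℕ) : Set (G → Bool) :=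
  { x | (∀ a b c : G, x a = true → x b = true → x c = true → a = b ∨ a = c ∨ b = c) ∧
        (∀ a b : G, x a = true → x b = true → a ≠ b → wordDist gen a b ∉ A) }

/-- Shift action on configurations. -/
def shiftC {G : Type*} [Group G] {α : Type*} (g : G) (x : G → α) : G → α :=
  fun k => x (g⁻¹ * k)

theorem shiftC_mem_XA {G : Type*} [Group G] {m : ℕ} (gen : Fin m → G) (A : Set ℕ)
    (g : G) {x : G → Bool} (hx : x ∈ XA gen A) : shiftC g x ∈ XA gen A := by
  obtain ⟨h1, h2⟩ := hx
  constructor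
  · intro a b c ha hb hc
    rcases h1 _ _ _ ha hb hc with h | h | h
    · exact Or.inl (mul_left_cancel h)
    · exact Or.inr (Or.inl (mul_left_cancel h))
    · exact Or.inr (Or.inr (mul_left_cancel h))
  · intro a b ha hb hab
    have hab' : g⁻¹ * a ≠ g⁻¹ * b := fun h => hab (mul_left_cancel h)
    have hd := h2 _ _ ha hb hab'
    have he : wordDist gen (g⁻¹ * a) (g⁻¹ * b) = wordDist gen a b := by
      unfold wordDist
      congr 1
      group
    rwa [he] at hd

/-- The generator `ĝ` of `K(G,A,H)`: shift in the first component. -/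
def ghat {G : Type*} [Group G] {m : ℕ} (gen : Fin m → G) (A : Set ℕ)
    (H : Type*) (g : G) : Equiv.Perm (↥(XA gen A) × H) where
  toFun p := (⟨shiftC g p.1.1, shiftC_mem_XA gen A g p.1.2⟩, p.2)
  invFun p := (⟨shiftC g⁻¹ p.1.1, shiftC_mem_XA gen A g⁻¹ p.1.2⟩, p.2)
  left_inv := by
    rintro ⟨⟨x, hx⟩, h'⟩
    simp only [Prod.mk.injEq, Subtype.mk.injEq]
    refine ⟨?_, trivial⟩
    funext k
    show x (g⁻¹ * ((g⁻¹)⁻¹ * k)) = x k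
    congr 1
    group
  right_inv := by
    rintro ⟨⟨x, hx⟩, h'⟩
    simp only [Prod.mk.injEq, Subtype.mk.injEq]
    refine ⟨?_, trivial⟩
    funext k
    show x ((g⁻¹)⁻¹ * (g⁻¹ * k)) = x k
    congr 1
    group

/-- The generator `h_b` of `K(G,A,H)`: multiply the `H`-component by `h`
if the configuration reads `b` at the identity. -/
def hbGen {G : Type*} [Group G] {m : ℕ} (gen : Fin m → G) (A : Set ℕ)
    {H : Type*} [Group H] (h : H) (b : Bool) : Equiv.Perm (↥(XA gen A) × H) where
  toFun p := (p.1, if p.1.1 1 = b then h * p.2 else p.2)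
  invFun p := (p.1, if p.1.1 1 = b then h⁻¹ * p.2 else p.2)
  left_inv := by
    rintro ⟨x, h'⟩
    by_cases hc : x.1 1 = b <;> simp [hc]
  right_inv := by
    rintro ⟨x, h'⟩
    by_cases hc : x.1 1 = b <;> simp [hc]

/-- The group `K(G,A,H)` as a subgroup of the permutations of `X_A × H`. -/
def Ksub {G : Type*} [Group G] {m : ℕ} (gen : Fin m → G) (A : Set ℕ)
    (H : Type*) [Group H] : Subgroup (Equiv.Perm (↥(XA gen A) × H)) :=
  Subgroup.closure
    ((Set.range fun g : G => ghat gen A H g) ∪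
     (Set.range fun p : H × Bool => hbGen gen A p.1 p.2))

theorem ghat_mem {G : Type*} [Group G] {m : ℕ} (gen : Fin m → G) (A : Set ℕ)
    (H : Type*) [Group H] (g : G) : ghat gen A H g ∈ Ksub gen A H :=
  Subgroup.subset_closure (Or.inl ⟨g, rfl⟩)

theorem hb_mem {G : Type*} [Group G] {m : ℕ} (gen : Fin m → G) (A : Set ℕ)
    {H : Type*} [Group H] (h : H) (b : Bool) : hbGen gen A h b ∈ Ksub gen A H :=
  Subgroup.subset_closure (Or.inr ⟨(h, b), rfl⟩)

/-- The distinguished generating set of `K(G,A,H)`: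
the `ĝ` for `g` among the generators of `G`, and the `h_b` for `h` among
the generators of `H` and `b ∈ {0,1}`. -/
def genKGen {G H : Type*} [Group G] [Group H] {mG nH : ℕ}
    (genG : Fin mG → G) (genH : Fin nH → H) (A : Set ℕ) :
    Fin (mG + 2 * nH) → ↥(Ksub genG A H) := fun i =>
  if h : (i : ℕ) < mG then ⟨ghat genG A H (genG ⟨i, h⟩), ghat_mem genG A H _⟩
  else
    ⟨hbGen genG A (genH ⟨((i : ℕ) - mG) / 2, by have := i.isLt; omega⟩)
        (decide (((i : ℕ) - mG) % 2 = 1)),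
      hb_mem genG A _ _⟩

section Helpers

variable {α β σ : Type*} [Primcodable α] [Primcodable β] [Primcodable σ]

theorem comp_foldl {f : α → List β} {g : α → σ} {h : α → σ × β → σ}
    (hf : Computable f) (hg : Computable g) (hh : Computable₂ h) :
    Computable fun a => (f a).foldl (fun s b => h a (s, b)) (g a) := by
  have h1 : Computable fun a => (Nat.rec (motive := fun _ => σ) (g a)
      (fun k IH => Option.casesOn (motive := fun _ => σ) ((f a)[k]?) IH (fun b => h a (IH, b)))
      (f a).length : σ) := by
    refine Computable.nat_rec (h := fun a p => Option.casesOn (motive := fun _ => σ)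
      ((f a)[p.1]?) p.2 (fun b => h a (p.2, b))) (Computable.list_length.comp hf) hg ?_
    refine Computable.option_casesOn (o := fun q : α × ℕ × σ => (f q.1)[q.2.1]?)
      (f := fun q => q.2.2) (g := fun q b => h q.1 (q.2.2, b)) ?_ ?_ ?_
    · exact Computable.list_getElem?.comp (hf.comp Computable.fst)
        (Computable.fst.comp Computable.snd)
    · exact Computable.snd.comp Computable.snd
    · exact hh.comp (Computable.fst.comp Computable.fst)
        ((Computable.snd.comp (Computable.snd.comp Computable.fst)).pair Computable.snd)
  refine h1.of_eq fun a => ?_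
  have key : ∀ n, n ≤ (f a).length → (Nat.rec (motive := fun _ => σ) (g a)
      (fun k IH => Option.casesOn (motive := fun _ => σ) ((f a)[k]?) IH (fun b => h a (IH, b)))
      n : σ) = ((f a).take n).foldl (fun s b => h a (s, b)) (g a) := by
    intro n
    induction n with
    | zero => intro _; simp
    | succ n ih =>
      intro hn
      have hn' : n < (f a).length := hn
      simp only [ih hn'.le, List.getElem?_eq_getElem hn']
      rw [List.take_succ_eq_append_getElem hn', List.foldl_append]
      simp
  simpa using key _ le_rfl

theorem comp_foldr {f : α → List β} {g : α → σ} {h : α → β × σ → σ}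
    (hf : Computable f) (hg : Computable g) (hh : Computable₂ h) :
    Computable fun a => (f a).foldr (fun b s => h a (b, s)) (g a) := by
  refine (comp_foldl (h := fun a p => h a (p.2, p.1))
    (Computable.list_reverse.comp hf) hg ?_).of_eq fun a => by simp [List.foldl_reverse]
  exact hh.comp Computable.fst ((Computable.snd.comp Computable.snd).pair
    (Computable.fst.comp Computable.snd))

theorem comp_and {p q : α → Bool} (hp : Computable p) (hq : Computable q) :
    Computable fun a => p a && q a := Primrec.and.to_comp.comp hp hq

theorem comp_or {p q : α → Bool} (hp : Computable p) (hq : Computable q) :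
    Computable fun a => p a || q a := Primrec.or.to_comp.comp hp hq

theorem comp_not {p : α → Bool} (hp : Computable p) :
    Computable fun a => !(p a) := Primrec.not.to_comp.comp hp

theorem comp_any {f : α → List β} {p : α → β → Bool} (hf : Computable f) (hp : Computable₂ p) :
    Computable fun a => (f a).any (p a) := by
  refine (comp_foldr (h := fun a q => p a q.1 || q.2) hf (Computable.const false) ?_).of_eq
    fun a => ?_
  · exact comp_or (hp.comp Computable.fst (Computable.fst.comp Computable.snd))
      (Computable.snd.comp Computable.snd)
  · induction f a <;> simp_all

theorem comp_all {f : α → List β} {p : α → β → Bool} (hf : Computable f) (hp : Computable₂ p) :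
    Computable fun a => (f a).all (p a) := by
  refine (comp_not (comp_any hf (p := fun a b => !(p a b)) (comp_not hp))).of_eq fun a => ?_
  induction f a <;> simp_all

/-- Step-indexed form of a Σ⁰₁ set. -/
theorem sigma_stage {S : Set ℕ} (hS : IsSigma01 S) :
    ∃ R : ℕ → ℕ → Bool, Computable₂ R ∧ (∀ n k k', k ≤ k' → R n k = true → R n k' = true) ∧
      ∀ n, n ∈ S ↔ ∃ k, R n k = true := by
  obtain ⟨f, hf, hS⟩ := hS
  obtain ⟨c, rfl⟩ := Nat.Partrec.Code.exists_code.1 (Partrec.nat_iff.1 hf)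
  refine ⟨fun n k => (Nat.Partrec.Code.evaln k c n).isSome, ?_, ?_, ?_⟩
  · exact Primrec.option_isSome.to_comp.comp (Nat.Partrec.Code.primrec_evaln.to_comp.comp
      ((Computable.snd.pair (Computable.const c)).pair Computable.fst))
  · intro n k k' hk h
    obtain ⟨x, hx⟩ := Option.isSome_iff_exists.1 h
    exact Option.isSome_iff_exists.2 ⟨x, Nat.Partrec.Code.evaln_mono hk hx⟩
  · intro n
    rw [hS, Part.dom_iff_mem]
    simp only [Nat.Partrec.Code.evaln_complete, Option.isSome_iff_exists]
    rw [exists_comm]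
    rfl

theorem sigma_of_exists {S : Set ℕ} (R : α → ℕ → Bool) (c : α → ℕ) (hR : Computable₂ R)
    (hc : Computable c) (h : ∀ n, n ∈ S ↔ ∃ a k, c a = n ∧ R a k = true) : IsSigma01 S := by
  let P : ℕ → ℕ → Bool := fun n t => Option.casesOn (motive := fun _ => Bool)
    (Encodable.decode (α := α × ℕ) t) false (fun q => (c q.1 == n) && R q.1 q.2)
  have hP : Computable₂ P := by
    refine Computable.option_casesOn (o := fun q : ℕ × ℕ => Encodable.decode (α := α × ℕ) q.2)
      (f := fun _ => false) (g := fun q r => (c r.1 == q.1) && R r.1 r.2) ?_ ?_ ?_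
    · exact Computable.decode.comp Computable.snd
    · exact Computable.const _
    · refine comp_and ?_ ?_
      · exact Primrec.beq.to_comp.comp (hc.comp (Computable.fst.comp Computable.snd))
          (Computable.fst.comp Computable.fst)
      · exact hR.comp (Computable.fst.comp Computable.snd) (Computable.snd.comp Computable.snd)
  refine ⟨fun n => Nat.rfind fun t => Part.some (P n t), Partrec.rfind hP.partrec.to₂, ?_⟩
  intro n
  rw [h]
  refine Iff.trans ?_ Nat.rfind_dom.symm
  constructor
  · rintro ⟨a, k, h1, h2⟩
    refine ⟨Encodable.encode (a, k), ?_, fun {_} _ => trivial⟩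
    simp [P, h1, h2, Part.mem_some_iff]
  · rintro ⟨t, ht, -⟩
    simp only [P, Part.mem_some_iff] at ht
    cases e : (Encodable.decode (α := α × ℕ) t) with
    | none => simp [e] at ht
    | some q =>
      simp [e] at ht
      exact ⟨q.1, q.2, ht.1, ht.2⟩

theorem mono_all {β : Type*} (L : List β) (P : β → ℕ → Prop)
    (hm : ∀ b k k', k ≤ k' → P b k → P b k') (h : ∀ b ∈ L, ∃ k, P b k) :
    ∃ k, ∀ b ∈ L, P b k := by
  induction L with
  | nil => exact ⟨0, by simp⟩
  | cons a L ih =>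
    obtain ⟨k1, h1⟩ := ih fun b hb => h b (by simp [hb])
    obtain ⟨k2, h2⟩ := h a (by simp)
    refine ⟨max k1 k2, fun b hb => ?_⟩
    rcases List.mem_cons.1 hb with rfl | hb
    · exact hm _ _ _ (le_max_right _ _) h2
    · exact hm _ _ _ (le_max_left _ _) (h1 b hb)

end Helpers

section Words

variable {K : Type*} [Group K] {m : ℕ} (gen : Fin m → K)

theorem evalWord_nil : evalWord gen [] = 1 := rfl

theorem evalWord_append (u v : List (Fin m × Bool)) :
    evalWord gen (u ++ v) = evalWord gen u * evalWord gen v := by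
  simp [evalWord]

theorem evalWord_cons (l : Fin m × Bool) (v : List (Fin m × Bool)) :
    evalWord gen (l :: v) = (if l.2 then gen l.1 else (gen l.1)⁻¹) * evalWord gen v := by
  simp [evalWord]

/-- Formal inverse of a word. -/
def winv (v : List (Fin m × Bool)) : List (Fin m × Bool) :=
  (v.map fun l => (l.1, !l.2)).reverse

theorem evalWord_winv (v : List (Fin m × Bool)) :
    evalWord gen (winv v) = (evalWord gen v)⁻¹ := by
  induction v with
  | nil => simp [winv, evalWord]
  | cons l v ih =>
    have : winv (l :: v) = winv v ++ [(l.1, !l.2)] := by simp [winv]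
    rw [this, evalWord_append, ih, evalWord_cons, evalWord_cons, evalWord_nil]
    rcases l with ⟨i, b⟩
    cases b <;> simp

theorem winv_computable : Computable (winv (m := m)) := by
  refine (Primrec.list_reverse.comp (Primrec.list_map Primrec.id ?_)).to_comp
  exact (Primrec.dom_finite (fun l : Fin m × Bool => (l.1, !l.2))).comp Primrec.snd

theorem exists_word (h : Subgroup.closure (Set.range gen) = ⊤) (g : K) :
    ∃ w, evalWord gen w = g := by
  have hg : g ∈ Subgroup.closure (Set.range gen) := h ▸ Subgroup.mem_top g
  induction hg using Subgroup.closure_induction with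
  | mem x hx => obtain ⟨i, rfl⟩ := hx; exact ⟨[(i, true)], by simp [evalWord]⟩
  | one => exact ⟨[], rfl⟩
  | mul x y _ _ hx hy =>
    obtain ⟨u, rfl⟩ := hx
    obtain ⟨v, rfl⟩ := hy
    exact ⟨u ++ v, evalWord_append gen u v⟩
  | inv x _ hx => obtain ⟨u, rfl⟩ := hx; exact ⟨winv u, evalWord_winv gen u⟩

theorem wordCode_concat (w : List (Fin m × Bool)) (l : Fin m × Bool) :
    wordCode (w ++ [l]) = wordCode w * (2 * m) + (2 * l.1.val + (if l.2 then 1 else 0) + 1) := by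
  simp [wordCode]

theorem wordCode_injective : Function.Injective (wordCode (m := m)) := by
  intro u
  induction u using List.reverseRecOn with
  | nil =>
    intro v h
    rcases List.eq_nil_or_concat v with rfl | ⟨v, l, rfl⟩
    · rfl
    · rw [List.concat_eq_append, wordCode_concat] at h
      simp [wordCode] at h
  | append_singleton u a ih =>
    intro v h
    rcases List.eq_nil_or_concat v with rfl | ⟨v, b, rfl⟩
    · rw [wordCode_concat] at h
      simp [wordCode] at h
    · rw [List.concat_eq_append] at h ⊢
      rw [wordCode_concat, wordCode_concat] at h
      have hlt : ∀ l : Fin m × Bool, 2 * l.1.val + (if l.2 then 1 else 0) < 2 * m := by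
        rintro ⟨⟨i, hi⟩, b⟩
        cases b <;> simp <;> omega
      have h' : wordCode u * (2 * m) + (2 * a.1.val + (if a.2 then 1 else 0)) =
        wordCode v * (2 * m) + (2 * b.1.val + (if b.2 then 1 else 0)) := by omega
      have hpos : 0 < 2 * m := lt_of_le_of_lt (Nat.zero_le _) (hlt a)
      have hd := congrArg (· / (2 * m)) h'
      have hm := congrArg (· % (2 * m)) h'
      simp only [mul_comm _ (2 * m), Nat.mul_add_div hpos, Nat.div_eq_of_lt (hlt _),
        Nat.mul_add_mod, Nat.mod_eq_of_lt (hlt _), add_zero] at hd hm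
      rw [ih hd]
      rcases a with ⟨⟨i, hi⟩, a⟩
      rcases b with ⟨⟨j, hj⟩, b⟩
      have : i = j ∧ a = b := by cases a <;> cases b <;> simp at hm ⊢ <;> omega
      simp [this.1, this.2]

theorem mem_WordProblem (w : List (Fin m × Bool)) :
    wordCode w ∈ WordProblem gen ↔ evalWord gen w = 1 := by
  constructor
  · rintro ⟨v, hv, h⟩
    rwa [← wordCode_injective hv]
  · exact fun h => ⟨w, rfl, h⟩

theorem wordCode_computable : Computable (wordCode (m := m)) := by
  refine (Primrec.list_foldl (h := fun (_ : List (Fin m × Bool)) (p : ℕ × (Fin m × Bool)) =>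
    p.1 * (2 * m) + (2 * p.2.1.val + (if p.2.2 then 1 else 0) + 1))
    Primrec.id (Primrec.const 0) ?_).to_comp
  refine Primrec.nat_add.comp (Primrec.nat_mul.comp (Primrec.fst.comp Primrec.snd)
    (Primrec.const _)) ?_
  exact (Primrec.dom_finite (fun l : Fin m × Bool =>
    2 * l.1.val + (if l.2 then 1 else 0) + 1)).comp (Primrec.snd.comp Primrec.snd)

/-- All words of length at most `n`. -/
def wordsLE (m : ℕ) (n : ℕ) : List (List (Fin m × Bool)) :=
  Nat.rec [[]] (fun _ L => [] :: L.flatMap fun w =>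
    (List.finRange m).flatMap fun i => [(i, true) :: w, (i, false) :: w]) n

theorem mem_wordsLE (n : ℕ) (w : List (Fin m × Bool)) : w ∈ wordsLE m n ↔ w.length ≤ n := by
  induction n generalizing w with
  | zero => simp [wordsLE]
  | succ n ih =>
    have : wordsLE m (n + 1) = [] :: (wordsLE m n).flatMap fun w =>
      (List.finRange m).flatMap fun i => [(i, true) :: w, (i, false) :: w] := rfl
    rw [this]
    rcases w with _ | ⟨⟨i, b⟩, w⟩
    · simp
    · simp only [List.mem_cons, reduceCtorEq, false_or, List.mem_flatMap, ih, List.length_cons,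
        add_le_add_iff_right, List.mem_finRange, true_and, List.cons.injEq, Prod.mk.injEq,
        List.not_mem_nil, or_false]
      constructor
      · rintro ⟨a, ha, j, h⟩
        rcases h with h | h <;> exact h.2 ▸ ha
      · intro h
        exact ⟨w, h, i, by cases b <;> simp⟩

theorem wordsLE_computable : Computable (wordsLE m) := by
  refine (Primrec.nat_rec₁ [[]] ?_).to_comp
  refine Primrec.list_cons.comp (Primrec.const _) ?_
  refine Primrec.list_flatMap (f := fun p : ℕ × List (List (Fin m × Bool)) => p.2)
    (g := fun _ w => (List.finRange m).flatMap fun i => [(i, true) :: w, (i, false) :: w])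
    Primrec.snd ?_
  refine Primrec.list_flatMap (f := fun _ => List.finRange m)
    (g := fun (p : (ℕ × List (List (Fin m × Bool))) × List (Fin m × Bool)) (i : Fin m) =>
      [(i, true) :: p.2, (i, false) :: p.2]) (Primrec.const _) ?_
  refine Primrec.list_cons.comp ?_ (Primrec.list_cons.comp ?_ (Primrec.const []))
  · exact Primrec.list_cons.comp (Primrec.snd.pair (Primrec.const true))
      (Primrec.snd.comp Primrec.fst)
  · exact Primrec.list_cons.comp (Primrec.snd.pair (Primrec.const false))
      (Primrec.snd.comp Primrec.fst)

/-- The word norm is computable when the word problem is decidable. -/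
theorem wordNorm_computable (h : Subgroup.closure (Set.range gen) = ⊤)
    (D : List (Fin m × Bool) → Bool) (hD : Computable D)
    (hDs : ∀ w, D w = true ↔ evalWord gen w = 1) :
    Computable fun u => wordNorm gen (evalWord gen u) := by
  let P : List (Fin m × Bool) → ℕ → Bool := fun u n =>
    (wordsLE m n).any fun v => D (v ++ winv u)
  have hP : Computable₂ P := by
    refine comp_any (f := fun q : List (Fin m × Bool) × ℕ => wordsLE m q.2)
      (p := fun q v => D (v ++ winv q.1)) (wordsLE_computable.comp Computable.snd) ?_
    exact hD.comp (Computable.list_append.comp Computable.snd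
      (winv_computable.comp (Computable.fst.comp Computable.fst)))
  have hPs : ∀ u n, P u n = true ↔ ∃ v : List (Fin m × Bool), v.length ≤ n ∧
      evalWord gen v = evalWord gen u := by
    intro u n
    simp [P, mem_wordsLE, hDs, evalWord_append, evalWord_winv, mul_inv_eq_one]
  have hr : Partrec fun u => Nat.rfind fun t => Part.some (P u t) :=
    Partrec.rfind hP.partrec.to₂
  refine hr.of_eq fun u => Part.eq_some_iff.2 ?_
  have hne : { ℓ | ∃ w : List (Fin m × Bool), w.length = ℓ ∧
      evalWord gen w = evalWord gen u }.Nonempty := ⟨_, u, rfl, rfl⟩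
  refine Nat.mem_rfind.2 ?_
  constructor
  · obtain ⟨w, hw, he⟩ := Nat.sInf_mem hne
    simp only [Part.mem_some_iff]
    exact ((hPs u _).2 ⟨w, hw.le, he⟩).symm
  · intro n hn
    simp only [Part.mem_some_iff]
    symm
    rw [← Bool.not_eq_true, hPs]
    rintro ⟨v, hv, he⟩
    have : wordNorm gen (evalWord gen u) ≤ v.length := Nat.sInf_le ⟨v, rfl, he⟩
    exact absurd hn (not_lt.2 (this.trans hv))

end Words

section Main

variable {G H : Type*} [Group G] [Group H] {mG nH : ℕ}

/-- The `G`-part of a letter. -/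
def gL (mG nH : ℕ) (l : Fin (mG + 2 * nH) × Bool) : List (Fin mG × Bool) :=
  if h : (l.1 : ℕ) < mG then [(⟨l.1, h⟩, l.2)] else []

/-- The `H`-part of a letter when the bit `b` is read. -/
def hL (mG nH : ℕ) (l : (Fin (mG + 2 * nH) × Bool) × Bool) : List (Fin nH × Bool) :=
  if h : (l.1.1 : ℕ) < mG then []
  else if l.2 = decide (((l.1.1 : ℕ) - mG) % 2 = 1) then
    [(⟨((l.1.1 : ℕ) - mG) / 2, by have := l.1.1.isLt; omega⟩, l.1.2)] else []

/-- Simulation of a word: the resulting `G`-word and `H`-word, when the tested bits are given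
by `T`. -/
def runW (T : List (Fin mG × Bool) → Bool) (w : List (Fin (mG + 2 * nH) × Bool)) :
    List (Fin mG × Bool) × List (Fin nH × Bool) :=
  w.foldr (fun l s => (gL mG nH l ++ s.1, hL mG nH (l, T s.1) ++ s.2)) ([], [])

theorem runW_cons (T : List (Fin mG × Bool) → Bool) (l) (w : List (Fin (mG + 2 * nH) × Bool)) :
    runW T (l :: w) = (gL mG nH l ++ (runW T w).1, hL mG nH (l, T (runW T w).1) ++ (runW T w).2) :=
  rfl

theorem runW_length (T : List (Fin mG × Bool) → Bool) (w : List (Fin (mG + 2 * nH) × Bool)) :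
    (runW T w).1.length ≤ w.length := by
  induction w with
  | nil => simp [runW]
  | cons l w ih =>
    rw [runW_cons]
    have : (gL mG nH l).length ≤ 1 := by unfold gL; split <;> simp
    simp only [List.length_append, List.length_cons]
    omega

theorem runW_fst (T T' : List (Fin mG × Bool) → Bool) (w : List (Fin (mG + 2 * nH) × Bool)) :
    (runW T w).1 = (runW T' w).1 := by
  induction w with
  | nil => rfl
  | cons l w ih => rw [runW_cons, runW_cons, ih]

variable (genG : Fin mG → G) (genH : Fin nH → H) (A : Set ℕ)

theorem shiftC_one (x : G → Bool) : shiftC 1 x = x := by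
  funext k; simp [shiftC]

theorem shiftC_mul (g h : G) (x : G → Bool) : shiftC (g * h) x = shiftC g (shiftC h x) := by
  funext k; simp [shiftC, mul_assoc]

theorem letter_act (l : Fin (mG + 2 * nH) × Bool) (x : XA genG A) (h' : H) :
    ((if l.2 then genKGen genG genH A l.1 else (genKGen genG genH A l.1)⁻¹ :
      Ksub genG A H) : Equiv.Perm (XA genG A × H)) (x, h') =
    (⟨shiftC (evalWord genG (gL mG nH l)) x.1, shiftC_mem_XA genG A _ x.2⟩,
      evalWord genH (hL mG nH (l, x.1 1)) * h') := by
  rcases l with ⟨i, b⟩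
  by_cases hi : (i : ℕ) < mG
  · cases b
    · simp only [genKGen, gL, hL, hi, dif_pos, Bool.false_eq_true, if_false, evalWord_cons,
        evalWord_nil, mul_one, one_mul, Subgroup.coe_inv]
      rfl
    · simp only [genKGen, gL, hL, hi, dif_pos, if_true, evalWord_cons,
        evalWord_nil, mul_one, one_mul]
      rfl
  · cases b
    · simp only [genKGen, gL, hL, hi, dif_neg, not_false_eq_true, Bool.false_eq_true, if_false,
        evalWord_nil, shiftC_one, Subgroup.coe_inv]
      refine Prod.ext rfl ?_
      show (if x.1 1 = _ then _ else _) = _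
      split <;> simp [evalWord]
    · simp only [genKGen, gL, hL, hi, dif_neg, not_false_eq_true, if_true,
        evalWord_nil, shiftC_one]
      refine Prod.ext rfl ?_
      show (if x.1 1 = _ then _ else _) = _
      split <;> simp [evalWord]

theorem word_act (T : List (Fin mG × Bool) → Bool) (w : List (Fin (mG + 2 * nH) × Bool))
    (x : XA genG A) (h' : H)
    (hT : ∀ u : List (Fin mG × Bool), u.length ≤ w.length → T u = x.1 (evalWord genG u)⁻¹) :
    ((evalWord (genKGen genG genH A) w : Ksub genG A H) : Equiv.Perm (XA genG A × H)) (x, h') =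
    (⟨shiftC (evalWord genG (runW T w).1) x.1, shiftC_mem_XA genG A _ x.2⟩,
      evalWord genH (runW T w).2 * h') := by
  induction w with
  | nil =>
    simp [runW, evalWord_nil, shiftC_one]
  | cons l w ih =>
    rw [evalWord_cons, Subgroup.coe_mul, Equiv.Perm.mul_apply,
      ih fun u hu => hT u (by simp; omega), letter_act, runW_cons]
    have hb : T (runW T w).1 = shiftC (evalWord genG (runW T w).1) x.1 1 := by
      rw [hT _ ((runW_length T w).trans (by simp))]
      simp [shiftC]
    refine Prod.ext (Subtype.ext ?_) ?_
    · simp only [evalWord_append, shiftC_mul]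
    · simp only [evalWord_append, hb, mul_assoc]

/-- Bit tests for the configuration given by a list of words. -/
def testC (D : List (Fin mG × Bool) → Bool) (c : List (List (Fin mG × Bool)))
    (u : List (Fin mG × Bool)) : Bool :=
  c.any fun v => D (u ++ winv v)

open Classical in
/-- The configuration given by a list of words. -/
noncomputable def confC (c : List (List (Fin mG × Bool))) : G → Bool :=
  fun a => decide (∃ v ∈ c, a = (evalWord genG v)⁻¹)

/-- The semantic condition for a word to be trivial. -/
theorem trivial_iff (D : List (Fin mG × Bool) → Bool)
    (hDs : ∀ w, D w = true ↔ evalWord genG w = 1) (w : List (Fin (mG + 2 * nH) × Bool)) :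
    evalWord (genKGen genG genH A) w = 1 ↔
      evalWord genG (runW (nH := nH) (testC D []) w).1 = 1 ∧
      evalWord genH (runW (testC D []) w).2 = 1 ∧
      ∀ u ∈ wordsLE mG w.length, ∀ v ∈ wordsLE mG w.length,
        evalWord genH (runW (testC D [u, v]) w).2 = 1 ∨
        (D (u ++ winv v) = false ∧ wordNorm genG (evalWord genG (u ++ winv v)) ∈ A) := by
  have hDe : ∀ u v, D (u ++ winv v) = true ↔ evalWord genG u = evalWord genG v := by
    intro u v
    rw [hDs, evalWord_append, evalWord_winv, mul_inv_eq_one]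
  have htest : ∀ c u, testC D c u = confC genG c (evalWord genG u)⁻¹ := by
    intro c u
    rw [Bool.eq_iff_iff]
    simp [testC, confC, hDe]
  constructor
  · intro hw
    have key : ∀ c, ∀ hc : confC genG c ∈ XA genG A,
        shiftC (evalWord genG (runW (nH := nH) (testC D c) w).1) (confC genG c) = confC genG c ∧
        evalWord genH (runW (testC D c) w).2 = 1 := by
      intro c hc
      have := word_act genG genH A (testC D c) w ⟨_, hc⟩ 1 fun u _ => htest c u
      rw [hw] at this
      simp only [Subgroup.coe_one, Equiv.Perm.one_apply, Prod.mk.injEq, Subtype.mk.injEq,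
        mul_one] at this
      exact ⟨this.1.symm, this.2.symm⟩
    refine ⟨?_, ?_, ?_⟩
    · have hc : confC genG [[]] ∈ XA genG A := by
        constructor
        · intro a b c ha hb _
          simp [confC, evalWord_nil] at ha hb
          exact Or.inl (ha.trans hb.symm)
        · intro a b ha hb hab
          simp [confC, evalWord_nil] at ha hb
          exact absurd (ha.trans hb.symm) hab
      have h1 := congrFun (key _ hc).1 1
      rw [runW_fst _ (testC D [])] at h1
      simpa [confC, shiftC, evalWord_nil] using h1
    · refine (key [] ?_).2
      constructor
      · intro a b c ha; simp [confC] at ha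
      · intro a b ha; simp [confC] at ha
    · intro u _ v _
      by_cases hA : D (u ++ winv v) = false ∧ wordNorm genG (evalWord genG (u ++ winv v)) ∈ A
      · exact Or.inr hA
      left
      refine (key [u, v] ?_).2
      constructor
      · intro a b c ha hb hc
        simp [confC] at ha hb hc
        grind
      · intro a b ha hb hab hdist
        simp [confC] at ha hb
        have hne : evalWord genG u ≠ evalWord genG v := by
          intro h; rw [h] at ha hb; apply hab; grind
        have hDf : D (u ++ winv v) = false := by
          rw [← Bool.not_eq_true, hDe]; exact hne
        have hnorm : wordDist genG a b = wordNorm genG (evalWord genG (u ++ winv v)) := by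
          have hsymm : ∀ g : G, wordNorm genG g⁻¹ = wordNorm genG g := by
            intro g
            unfold wordNorm
            congr 1
            ext ℓ
            constructor
            · rintro ⟨w, h1, h2⟩
              exact ⟨winv w, by simpa [winv] using h1, by rw [evalWord_winv, h2, inv_inv]⟩
            · rintro ⟨w, h1, h2⟩
              exact ⟨winv w, by simpa [winv] using h1, by rw [evalWord_winv, h2]⟩
          rw [evalWord_append, evalWord_winv, wordDist]
          rcases ha with rfl | rfl <;> rcases hb with rfl | rfl
          · exact absurd rfl hab
          · rw [inv_inv]
          · rw [← hsymm]; simp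
          · exact absurd rfl hab
        exact hA ⟨hDf, hnorm ▸ hdist⟩
  · rintro ⟨hg, h0, h2⟩
    apply Subtype.ext
    apply Equiv.ext
    rintro ⟨x, h'⟩
    have key : ∀ c, (∀ u : List (Fin mG × Bool), u.length ≤ w.length →
        testC D c u = x.1 (evalWord genG u)⁻¹) → evalWord genH (runW (testC D c) w).2 = 1 →
        ((evalWord (genKGen genG genH A) w : Ksub genG A H) : Equiv.Perm (XA genG A × H)) (x, h') = (x, h') := by
      intro c hc h
      rw [word_act genG genH A (testC D c) w x h' hc, runW_fst _ (testC D []), hg, h]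
      simp [shiftC_one]
    show _ = (x, h')
    have hx1 := x.2.1
    have hx2 := x.2.2
    by_cases hz : ∀ u : List (Fin mG × Bool), u.length ≤ w.length →
        x.1 (evalWord genG u)⁻¹ = false
    · exact key [] (fun u hu => by rw [hz u hu]; rfl) h0
    push Not at hz
    obtain ⟨u, hu, hxu⟩ := hz
    simp only [ne_eq, Bool.not_eq_false] at hxu
    by_cases hs : ∀ v : List (Fin mG × Bool), v.length ≤ w.length →
        x.1 (evalWord genG v)⁻¹ = true → evalWord genG v = evalWord genG u
    · have hDu : D (u ++ winv u) = true := (hDe u u).2 rfl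
      refine key [u, u] (fun v hv => ?_) ?_
      · rw [Bool.eq_iff_iff]
        simp only [testC, List.any_cons, List.any_nil, Bool.or_false, Bool.or_self, hDe]
        exact ⟨fun h => h ▸ hxu, hs v hv⟩
      · rcases h2 u ((mem_wordsLE _ _).2 hu) u ((mem_wordsLE _ _).2 hu) with h | h
        · exact h
        · rw [hDu] at h; exact absurd h.1 (by simp)
    push Not at hs
    obtain ⟨v, hv, hxv, hne⟩ := hs
    refine key [u, v] (fun t ht => ?_) ?_
    · rw [Bool.eq_iff_iff]
      simp only [testC, List.any_cons, List.any_nil, Bool.or_false, Bool.or_eq_true, hDe]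
      constructor
      · rintro (h | h) <;> rw [h] <;> assumption
      · intro hxt
        rcases hx1 _ _ _ hxt hxu hxv with h | h | h
        · exact Or.inl (inv_injective h)
        · exact Or.inr (inv_injective h)
        · exact absurd (inv_injective h).symm hne
    · rcases h2 u ((mem_wordsLE _ _).2 hu) v ((mem_wordsLE _ _).2 hv) with h | h
      · exact h
      · refine absurd h.2 ?_
        have := hx2 _ _ hxu hxv (fun h => hne (inv_injective h).symm)
        rwa [wordDist, inv_inv, ← evalWord_winv, ← evalWord_append] at this

theorem runW_computable (D : List (Fin mG × Bool) → Bool) (hD : Computable D) :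
    Computable₂ fun (c : List (List (Fin mG × Bool))) (w : List (Fin (mG + 2 * nH) × Bool)) =>
      runW (testC D c) w := by
  have hT : Computable₂ (testC D) := by
    refine comp_any (f := fun q : List (List (Fin mG × Bool)) × List (Fin mG × Bool) => q.1)
      (p := fun q v => D (q.2 ++ winv v)) Computable.fst ?_
    exact hD.comp (Computable.list_append.comp (Computable.snd.comp Computable.fst)
      (winv_computable.comp Computable.snd))
  refine comp_foldr
    (f := fun q : List (List (Fin mG × Bool)) × List (Fin (mG + 2 * nH) × Bool) => q.2)
    (g := fun _ => (([], []) : List (Fin mG × Bool) × List (Fin nH × Bool)))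
    (h := fun q p => (gL mG nH p.1 ++ p.2.1, hL mG nH (p.1, testC D q.1 p.2.1) ++ p.2.2))
    Computable.snd (Computable.const _) ?_
  have e1 : Computable (gL mG nH) := (Primrec.dom_finite _).to_comp
  have e2 : Computable (hL mG nH) := (Primrec.dom_finite _).to_comp
  have p1 := Computable.fst (α := List (List (Fin mG × Bool)) × List (Fin (mG + 2 * nH) × Bool))
    (β := (Fin (mG + 2 * nH) × Bool) × List (Fin mG × Bool) × List (Fin nH × Bool))
  have p2 := Computable.snd (α := List (List (Fin mG × Bool)) × List (Fin (mG + 2 * nH) × Bool))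
    (β := (Fin (mG + 2 * nH) × Bool) × List (Fin mG × Bool) × List (Fin nH × Bool))
  have hl := Computable.fst.comp p2
  have hu := Computable.fst.comp (Computable.snd.comp p2)
  have hh := Computable.snd.comp (Computable.snd.comp p2)
  refine Computable.pair ?_ ?_
  · exact Computable.list_append.comp (e1.comp hl) hu
  · exact Computable.list_append.comp
      (e2.comp (hl.pair (hT.comp (Computable.fst.comp p1) hu))) hh

end Main

/-- If `G` has decidable word problem, `H` is finitely generated and
recursively presented and `A` is Σ⁰₁, then `K(G,A,H)` is recursively presented. -/
theorem Ksub_recursively_presented {G H : Type*} [Group G] [Group H] {mG nH : ℕ}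
    (genG : Fin mG → G) (genH : Fin nH → H)
    (hG : Subgroup.closure (Set.range genG) = ⊤)
    (hH : Subgroup.closure (Set.range genH) = ⊤)
    (hdecG : ComputablePred (· ∈ WordProblem genG))
    (hrpH : IsSigma01 (WordProblem genH))
    (A : Set ℕ) (hA : IsSigma01 A) :
    IsSigma01 (WordProblem (genKGen genG genH A)) := by
  obtain ⟨RH, hRHc, hRHm, hRH⟩ := sigma_stage hrpH
  obtain ⟨RA, hRAc, hRAm, hRA⟩ := sigma_stage hA
  obtain ⟨D, hD, hDs⟩ : ∃ D : List (Fin mG × Bool) → Bool, Computable D ∧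
      ∀ w, D w = true ↔ evalWord genG w = 1 := by
    obtain ⟨_, hc⟩ := hdecG
    exact ⟨_, hc.comp wordCode_computable, fun w => by
      rw [decide_eq_true_iff]; exact mem_WordProblem genG w⟩
  have hN := wordNorm_computable genG hG D hD hDs
  have hrun := runW_computable (nH := nH) D hD
  let W := List (Fin (mG + 2 * nH) × Bool)
  let V := List (Fin mG × Bool)
  let Q : W → V → V → ℕ → Bool := fun w u v k =>
    RH (wordCode (runW (testC D [u, v]) w).2) k ||
      (!(D (u ++ winv v)) && RA (wordNorm genG (evalWord genG (u ++ winv v))) k)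
  let R : W → ℕ → Bool := fun w k =>
    D (runW (nH := nH) (testC D []) w).1 &&
    (RH (wordCode (runW (testC D []) w).2) k &&
    (wordsLE mG w.length).all fun u => (wordsLE mG w.length).all fun v => Q w u v k)
  have hQ : Computable fun q : ((W × ℕ) × V) × V => Q q.1.1.1 q.1.2 q.2 q.1.1.2 := by
    have cw : Computable fun q : ((W × ℕ) × V) × V => q.1.1.1 :=
      Computable.fst.comp (Computable.fst.comp Computable.fst)
    have ck : Computable fun q : ((W × ℕ) × V) × V => q.1.1.2 :=
      Computable.snd.comp (Computable.fst.comp Computable.fst)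
    have cu : Computable fun q : ((W × ℕ) × V) × V => q.1.2 :=
      Computable.snd.comp Computable.fst
    have cv : Computable fun q : ((W × ℕ) × V) × V => q.2 := Computable.snd
    have cuv : Computable fun q : ((W × ℕ) × V) × V => q.1.2 ++ winv q.2 :=
      Computable.list_append.comp cu (winv_computable.comp cv)
    have cl : Computable fun q : ((W × ℕ) × V) × V => [q.1.2, q.2] :=
      Computable.list_cons.comp cu (Computable.list_cons.comp cv (Computable.const []))
    refine comp_or ?_ (comp_and (comp_not ?_) ?_)
    · exact hRHc.comp (wordCode_computable.comp (Computable.snd.comp (hrun.comp cl cw))) ck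
    · exact hD.comp cuv
    · exact hRAc.comp (hN.comp cuv) ck
  have hR : Computable₂ R := by
    have c0 : Computable fun q : W × ℕ => runW (nH := nH) (testC D []) q.1 :=
      hrun.comp (Computable.const []) Computable.fst
    have cL : Computable fun q : W × ℕ => wordsLE mG q.1.length :=
      wordsLE_computable.comp (Computable.list_length.comp Computable.fst)
    refine comp_and ?_ (comp_and ?_ ?_)
    · exact hD.comp (Computable.fst.comp c0)
    · exact hRHc.comp (wordCode_computable.comp (Computable.snd.comp c0)) Computable.snd
    · refine comp_all (f := fun q : W × ℕ => wordsLE mG q.1.length)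
        (p := fun q u => (wordsLE mG q.1.length).all fun v => Q q.1 u v q.2) cL ?_
      exact comp_all (f := fun q : (W × ℕ) × V => wordsLE mG q.1.1.length)
        (p := fun q v => Q q.1.1 q.2 v q.1.2) (cL.comp Computable.fst) hQ
  have hQs : ∀ w u v, (∃ k, Q w u v k = true) ↔
      (evalWord genH (runW (testC D [u, v]) w).2 = 1 ∨
        (D (u ++ winv v) = false ∧ wordNorm genG (evalWord genG (u ++ winv v)) ∈ A)) := by
    intro w u v
    rw [← mem_WordProblem genH, hRH, hRA]
    simp [Q, exists_or]
  have hQm : ∀ w u v k k', k ≤ k' → Q w u v k = true → Q w u v k' = true := by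
    intro w u v k k' hk h
    simp only [Q, Bool.or_eq_true, Bool.and_eq_true] at h ⊢
    exact h.imp (hRHm _ _ _ hk) (And.imp_right (hRAm _ _ _ hk))
  refine sigma_of_exists R wordCode hR wordCode_computable fun n => ?_
  refine exists_congr fun w => ?_
  rw [exists_and_left]
  refine and_congr_right fun _ => ?_
  rw [trivial_iff genG genH A D hDs]
  constructor
  · rintro ⟨h1, h2, h3⟩
    rw [← mem_WordProblem genH, hRH] at h2
    obtain ⟨k1, hk1⟩ := h2
    obtain ⟨k2, hk2⟩ := mono_all (wordsLE mG w.length)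
      (fun u k => ∀ v ∈ wordsLE mG w.length, Q w u v k = true)
      (fun u k k' hk h v hv => hQm _ _ _ _ _ hk (h v hv))
      (fun u hu => mono_all _ (fun v k => Q w u v k = true)
        (fun v k k' hk h => hQm _ _ _ _ _ hk h) (fun v hv => (hQs w u v).2 (h3 u hu v hv)))
    refine ⟨max k1 k2, ?_⟩
    simp only [R, Bool.and_eq_true, List.all_eq_true]
    exact ⟨(hDs _).2 h1, hRHm _ _ _ (le_max_left _ _) hk1,
      fun u hu v hv => hQm _ _ _ _ _ (le_max_right _ _) (hk2 u hu v hv)⟩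
  · rintro ⟨k, hk⟩
    simp only [R, Bool.and_eq_true, List.all_eq_true] at hk
    obtain ⟨h1, h2, h3⟩ := hk
    refine ⟨(hDs _).1 h1, ?_, fun u hu v hv => (hQs w u v).1 ⟨k, h3 u hu v hv⟩⟩
    rw [← mem_WordProblem genH, hRH]
    exact ⟨k, h2⟩
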